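/- For any sequence D of length n over colors {black, red, other}, Z(D) = Σ_{i : D(i)=black} (n + 1 - 2i + o_<(i) - o_>(i)), where o_<(i) is the number of 'other' entries before position i and o_>(i) is the number after position i, and Z(D) is the signed count of black-red pairs minus red-black pairs. -/

import Mathlib

open Finset

inductive Color | black | red | other
deriving DecidableEq

/-- Signed count of black-red pairs minus red-black pairs. -/
def Z {n : ℕ} (D : Fin n → Color) : ℤ :=
  ((univ.filter fun p : Fin n × Fin n =>
      p.1 < p.2 ∧ D p.1 = Color.black ∧ D p.2 = Color.red).card : ℤ)
  - ((univ.filter fun p : Fin n × Fin n =>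
      p.1 < p.2 ∧ D p.1 = Color.red ∧ D p.2 = Color.black).card : ℤ)

theorem aux_total {n : ℕ} (i : Fin n) :
    (∑ j : Fin n, ((if i < j then (1:ℤ) else 0) - (if j < i then 1 else 0)))
      = (n : ℤ) + 1 - 2 * (((i : ℕ) : ℤ) + 1) := by
  rw [sum_sub_distrib, sum_boole, sum_boole]
  have h1 : (univ.filter fun j : Fin n => i < j) = Ioi i := by ext; simp
  have h2 : (univ.filter fun j : Fin n => j < i) = Iio i := by ext; simp
  rw [h1, h2, Fin.card_Ioi, Fin.card_Iio]
  have := i.isLt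
  omega

theorem aux_anti {n : ℕ} (D : Fin n → Color) :
    (∑ i : Fin n, ∑ j : Fin n, (if D i = Color.black ∧ D j = Color.black then
      ((if i < j then (1:ℤ) else 0) - (if j < i then 1 else 0)) else 0)) = 0 := by
  have h : ∀ f : Fin n → Fin n → ℤ, (∀ i j, f i j = - f j i) → ∑ i, ∑ j, f i j = 0 := by
    intro f hf
    have h1 : ∑ i, ∑ j, f i j = - ∑ i, ∑ j, f i j := by
      conv_lhs => rw [sum_comm]
      rw [← sum_neg_distrib]
      refine sum_congr rfl fun i _ => ?_
      rw [← sum_neg_distrib]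
      exact sum_congr rfl fun j _ => hf j i
    omega
  apply h
  intro i j
  by_cases h1 : D i = Color.black <;> by_cases h2 : D j = Color.black <;> simp [h1, h2]

/-- `Z(D)` equals the sum over black (1-indexed) positions `i` of
`n + 1 - 2i + (#other before i) - (#other after i)`. -/
theorem Z_eq_sum_over_black {n : ℕ} (D : Fin n → Color) :
    Z D = ∑ i ∈ univ.filter (fun i : Fin n => D i = Color.black),
      ((n : ℤ) + 1 - 2 * (((i : ℕ) : ℤ) + 1)
        + ((univ.filter fun j : Fin n => j < i ∧ D j = Color.other).card : ℤ)
        - ((univ.filter fun j : Fin n => i < j ∧ D j = Color.other).card : ℤ)) := by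
  have e1 : Z D = ∑ i : Fin n, ∑ j : Fin n, (if D i = Color.black ∧ D j = Color.red then
      ((if i < j then (1:ℤ) else 0) - (if j < i then 1 else 0)) else 0) := by
    unfold Z
    rw [← sum_boole, ← sum_boole, Fintype.sum_prod_type, Fintype.sum_prod_type,
      sum_comm (f := fun x y : Fin n => if (x, y).1 < (x, y).2 ∧ D (x, y).1 = Color.red ∧
        D (x, y).2 = Color.black then (1:ℤ) else 0), ← sum_sub_distrib]
    refine sum_congr rfl fun i _ => ?_
    rw [← sum_sub_distrib]
    refine sum_congr rfl fun j _ => ?_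
    by_cases h1 : D i = Color.black <;> by_cases h2 : D j = Color.red <;> simp [h1, h2]
  have e2 := congrArg₂ (· + ·) e1 (aux_anti D).symm
  simp only [add_zero] at e2
  rw [e2, ← sum_add_distrib, sum_filter]
  refine sum_congr rfl fun i _ => ?_
  rw [← aux_total, ← sum_boole, ← sum_boole, ← sum_add_distrib, ← sum_add_distrib,
    ← sum_sub_distrib]
  by_cases h1 : D i = Color.black
  · rw [if_pos h1]
    refine sum_congr rfl fun j _ => ?_
    cases h2 : D j <;> simp [h1]
  · simp [h1]
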